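/- For k ≥ 1 there exist continuous maps φ_k: Δ^k → Δ^k and φ̃_{k+1}: Δ^{k+1} → Δ^{k+1} such that: (i) φ_k is smooth outside the (k−2)-skeleton of Δ^k and φ̃_{k+1} is smooth outside the (k−1)-skeleton of Δ^{k+1}; (ii) φ_k restricts to the radial projection π̃^k_p onto the face Δ^k_p on the neighborhood U^k_p of the interior of that face, and φ_k commutes with the affine action of every vertex permutation of Δ^k; (iii) φ̃_{k+1} restricts to the projection π̃^{k+1}_{p,q} onto codimension-two faces on the neighborhoods U^{k+1}_{p,q}, commutes with all vertex permutations of Δ^{k+1}, and satisfies φ̃_{k+1} ∘ ι_{k+1,p} = ι_{k+1,p} ∘ φ_k for every face inclusion ι_{k+1,p}. -/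

import Mathlib

open scoped BigOperators
noncomputable section

/-- The standard simplex with `n+1` vertices, in barycentric coordinates. -/
def simplexSet (n : ℕ) : Set (Fin (n+1) → ℝ) := stdSimplex ℝ (Fin (n+1))

/-- The vertex `e_p` in barycentric coordinates. -/
def vtx {n : ℕ} (p : Fin n) : Fin n → ℝ := fun r => if r = p then 1 else 0

/-- The affine action of a vertex permutation on barycentric coordinates. -/
def permAct {n : ℕ} (σ : Equiv.Perm (Fin n)) (x : Fin n → ℝ) : Fin n → ℝ :=
  fun r => x (σ⁻¹ r)

/-- The `(codim 2)`-skeleton: points where at least two barycentric coordinates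
vanish. -/
def skel2 {n : ℕ} : Set (Fin n → ℝ) :=
  { x | ∃ p q : Fin n, p ≠ q ∧ x p = 0 ∧ x q = 0 }

/-- The radial projection `π̃^k_p` onto the facet opposite `e_p`. -/
def radialProj (k : ℕ) (p : Fin (k+1)) (x : Fin (k+1) → ℝ) : Fin (k+1) → ℝ :=
  fun r => if r = p then 0 else x r / (1 - x p)

/-- The projection `π̃^{k+1}_{p,q}` onto the codimension-two face `Δ^{k+1}_{p,q}`. -/
def pairProj (k : ℕ) (p q : Fin (k+2)) (x : Fin (k+2) → ℝ) : Fin (k+2) → ℝ :=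
  fun r => if r = p ∨ r = q then 0 else x r / (1 - x p - x q)

/-- The point `b'_{k,p}` (barycenter of the simplex spanned by `b_k` and the vertices
of `Δ^k_p`): `b'_{k,p} = (1/(k+1))(b_k + Σ_{q≠p} e_q)`. -/
def bprime (k : ℕ) (p : Fin (k+1)) : Fin (k+1) → ℝ :=
  fun r => (1/(k+1)) * ((1/(k+1)) + if r = p then 0 else 1)

/-- The neighborhood `U^k_p` of the interior of the facet `Δ^k_p`:
points `t_p·b'_{k,p} + Σ_{q≠p} t_q·e_q` with `t_p ≥ 0`, `t_q > 0` for `q ≠ p`,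
`Σ t = 1`. -/
def Uface (k : ℕ) (p : Fin (k+1)) : Set (Fin (k+1) → ℝ) :=
  { x | ∃ t : Fin (k+1) → ℝ,
      0 ≤ t p ∧ (∀ q, q ≠ p → 0 < t q) ∧ (∑ q, t q) = 1 ∧
      x = t p • bprime k p + ∑ q ∈ Finset.univ.filter (fun q => q ≠ p), t q • vtx q }

/-- The point `ι_{k+1,p}(b'_{k,·})` of the facet `Δ^{k+1}_p` associated with its
sub-facet `Δ^{k+1}_{p,q}`: zero at `p`, `(1/(k+1))·(1/(k+1))` at `q`, and
`(1/(k+1))·(1/(k+1)+1)` elsewhere. -/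
def cprime (k : ℕ) (p q : Fin (k+2)) : Fin (k+2) → ℝ :=
  fun j => if j = p then 0 else (1/(k+1)) * ((1/(k+1)) + if j = q then 0 else 1)

/-- The neighborhood `U^{k+1}_{p,q}` of the interior of the codimension-two face
`Δ^{k+1}_{p,q}`. -/
def Upair (k : ℕ) (p q : Fin (k+2)) : Set (Fin (k+2) → ℝ) :=
  { x | ∃ t : Fin (k+2) → ℝ,
      0 ≤ t p ∧ 0 ≤ t q ∧ (∀ r, r ≠ p → r ≠ q → 0 < t r) ∧ (∑ r, t r) = 1 ∧
      x = t p • cprime k p q + t q • cprime k q p +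
          ∑ r ∈ Finset.univ.filter (fun r => r ≠ p ∧ r ≠ q), t r • vtx r }

/-- The face inclusion `ι_{k+1,p} : Δ^k → Δ^{k+1}` in barycentric coordinates. -/
def insertZero {k : ℕ} (p : Fin (k+2)) (y : Fin (k+1) → ℝ) : Fin (k+2) → ℝ :=
  fun j => ∑ i, if p.succAbove i = j then y i else 0

section WeightedNormalization

variable {ι : Type*} [Fintype ι]

/-- Scale the `r`-th coordinate by `1 - w x r`, then normalize the coordinate sum to one. -/
def dampedNormalize (w : (ι → ℝ) → ι → ℝ) (x : ι → ℝ) : ι → ℝ :=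
  fun r => x r * (1 - w x r) / ∑ s, x s * (1 - w x s)

lemma damped_nonneg {w : (ι → ℝ) → ι → ℝ} {x : ι → ℝ} (hx : x ∈ stdSimplex ℝ ι)
    (hw : ∀ r, w x r ≤ 1) (r : ι) : 0 ≤ x r * (1 - w x r) :=
  mul_nonneg (hx.1 r) (sub_nonneg.2 (hw r))

/-- A point of the simplex has a positive coordinate that dominates all the others. -/
lemma exists_max_coord_pos {x : ι → ℝ} (hx : x ∈ stdSimplex ℝ ι) :
    ∃ r, 0 < x r ∧ ∀ q, x q ≤ x r := by
  obtain ⟨i, -, hi⟩ : ∃ i ∈ Finset.univ, 0 < x i := by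
    apply Finset.exists_lt_of_sum_lt (f := fun _ : ι => (0 : ℝ))
    simp [hx.2]
  obtain ⟨r, -, hr⟩ := Finset.exists_max_image Finset.univ x ⟨i, Finset.mem_univ i⟩
  exact ⟨r, hi.trans_le (hr i (Finset.mem_univ i)), fun q => hr q (Finset.mem_univ q)⟩

lemma damped_sum_pos {w : (ι → ℝ) → ι → ℝ} {x : ι → ℝ} (hx : x ∈ stdSimplex ℝ ι)
    (hw : ∀ r, w x r ≤ 1) (hmax : ∀ r, (∀ q, x q ≤ x r) → w x r = 0) :
    0 < ∑ s, x s * (1 - w x s) := by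
  obtain ⟨r, hr, hq⟩ := exists_max_coord_pos hx
  refine Finset.sum_pos' (fun s _ => damped_nonneg hx hw s) ⟨r, Finset.mem_univ r, ?_⟩
  simpa [hmax r hq] using hr

lemma mapsTo_dampedNormalize {w : (ι → ℝ) → ι → ℝ}
    (hw : ∀ x ∈ stdSimplex ℝ ι, ∀ r, w x r ≤ 1)
    (hmax : ∀ x ∈ stdSimplex ℝ ι, ∀ r, (∀ q, x q ≤ x r) → w x r = 0) :
    Set.MapsTo (dampedNormalize w) (stdSimplex ℝ ι) (stdSimplex ℝ ι) := by
  intro x hx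
  have hpos := damped_sum_pos hx (hw x hx) (hmax x hx)
  refine ⟨fun r => div_nonneg (damped_nonneg hx (hw x hx) r) hpos.le, ?_⟩
  simp only [dampedNormalize]
  rw [← Finset.sum_div, div_self hpos.ne']

/-- Continuity of the weight of a coordinate is only needed where that coordinate is positive. -/
lemma continuousOn_dampedNormalize {w : (ι → ℝ) → ι → ℝ}
    (hw₀ : ∀ x ∈ stdSimplex ℝ ι, ∀ r, 0 ≤ w x r)
    (hw₁ : ∀ x ∈ stdSimplex ℝ ι, ∀ r, w x r ≤ 1)
    (hmax : ∀ x ∈ stdSimplex ℝ ι, ∀ r, (∀ q, x q ≤ x r) → w x r = 0)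
    (hcont : ∀ x ∈ stdSimplex ℝ ι, ∀ r, 0 < x r → ContinuousAt (fun y => w y r) x) :
    ContinuousOn (dampedNormalize w) (stdSimplex ℝ ι) := by
  have key : ∀ r, ContinuousOn (fun x => x r * (1 - w x r)) (stdSimplex ℝ ι) := by
    intro r x hx
    rcases (hx.1 r).eq_or_lt with h0 | hpos
    · have hlim : Filter.Tendsto (fun y : ι → ℝ => y r) (nhdsWithin x (stdSimplex ℝ ι))
          (nhds 0) := by
        have := (continuous_apply (A := fun _ : ι => ℝ) r).continuousWithinAt
          (s := stdSimplex ℝ ι) (x := x)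
        rwa [ContinuousWithinAt, ← h0] at this
      rw [ContinuousWithinAt, ← h0, zero_mul]
      refine squeeze_zero' ?_ ?_ hlim
      · filter_upwards [self_mem_nhdsWithin] with y hy using damped_nonneg hy (hw₁ y hy) r
      · filter_upwards [self_mem_nhdsWithin] with y hy
        exact mul_le_of_le_one_right (hy.1 r) (by linarith [hw₀ y hy r])
    · exact ((continuous_apply r).continuousAt.mul
        (continuousAt_const.sub (hcont x hx r hpos))).continuousWithinAt
  refine continuousOn_pi.2 fun r => (key r).div (continuousOn_finsetSum _ fun s _ => key s) ?_
  exact fun x hx => (damped_sum_pos hx (hw₁ x hx) (hmax x hx)).ne'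

lemma contDiffOn_dampedNormalize {w : (ι → ℝ) → ι → ℝ} {t : Set (ι → ℝ)}
    (ht : t ⊆ stdSimplex ℝ ι)
    (hw : ∀ x ∈ stdSimplex ℝ ι, ∀ r, w x r ≤ 1)
    (hmax : ∀ x ∈ stdSimplex ℝ ι, ∀ r, (∀ q, x q ≤ x r) → w x r = 0)
    (hsmooth : ∀ r, ContDiffOn ℝ (⊤ : ℕ∞) (fun y => w y r) t) :
    ContDiffOn ℝ (⊤ : ℕ∞) (dampedNormalize w) t := by
  have key : ∀ r, ContDiffOn ℝ (⊤ : ℕ∞) (fun x => x r * (1 - w x r)) t := fun r =>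
    (contDiff_apply ℝ ℝ r).contDiffOn.mul (contDiffOn_const.sub (hsmooth r))
  refine contDiffOn_pi.2 fun r => (key r).div (ContDiffOn.sum fun s _ => key s) ?_
  exact fun x hx => (damped_sum_pos (ht hx) (hw x (ht hx)) (hmax x (ht hx))).ne'

/-- If the weight is the indicator of a finite set `S`, the coordinates in `S` are removed. -/
lemma dampedNormalize_of_indicator [DecidableEq ι] {w : (ι → ℝ) → ι → ℝ} {x : ι → ℝ}
    (hx : ∑ r, x r = 1) (S : Finset ι)
    (hS : ∀ r ∈ S, w x r = 1) (hSc : ∀ r, r ∉ S → w x r = 0) (r : ι) :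
    dampedNormalize w x r = if r ∈ S then 0 else x r / (1 - ∑ s ∈ S, x s) := by
  have hterm : ∀ s, x s * (1 - w x s) = if s ∈ S then 0 else x s := by
    intro s
    split_ifs with h
    · simp [hS s h]
    · simp [hSc s h]
  have hsum : ∑ s, x s * (1 - w x s) = 1 - ∑ s ∈ S, x s := by
    have hite : ∀ s, (if s ∈ S then 0 else x s) = x s - if s ∈ S then x s else 0 := by
      intro s
      split_ifs <;> simp
    simp only [hterm, hite, Finset.sum_sub_distrib, hx, Finset.sum_ite_mem, Finset.univ_inter]
  rw [dampedNormalize, hsum, hterm]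
  split_ifs <;> simp

end WeightedNormalization

lemma dampedNormalize_permAct {n : ℕ} {w : (Fin n → ℝ) → Fin n → ℝ}
    (hw : ∀ (σ : Equiv.Perm (Fin n)) x r, w (permAct σ x) r = w x (σ⁻¹ r))
    (σ : Equiv.Perm (Fin n)) (x : Fin n → ℝ) :
    dampedNormalize w (permAct σ x) = permAct σ (dampedNormalize w x) := by
  funext r
  simp only [dampedNormalize, hw]
  simp only [permAct]
  rw [Equiv.sum_comp σ⁻¹ (fun s => x s * (1 - w x s)), dampedNormalize]

/-- A smooth function of the ratio `a / b` equal to `0` for `a ≤ b` and to `1` for `3 b ≤ a`. -/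
def gapStep (a b : ℝ) : ℝ := Real.smoothTransition (4 * (a / (a + b)) - 2)

lemma gapStep_nonneg (a b : ℝ) : 0 ≤ gapStep a b := Real.smoothTransition.nonneg _

lemma gapStep_le_one (a b : ℝ) : gapStep a b ≤ 1 := Real.smoothTransition.le_one _

lemma gapStep_eq_zero {a b : ℝ} (ha : 0 ≤ a) (hab : a ≤ b) : gapStep a b = 0 := by
  apply Real.smoothTransition.zero_of_nonpos
  have : a / (a + b) ≤ 1 / 2 := div_le_of_le_mul₀ (by linarith) (by norm_num) (by linarith)
  linarith

lemma gapStep_eq_one {a b : ℝ} (hb : 0 ≤ b) (ha : 0 < a) (hab : 3 * b ≤ a) :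
    gapStep a b = 1 := by
  apply Real.smoothTransition.one_of_one_le
  have : 3 / 4 ≤ a / (a + b) := by
    rw [le_div_iff₀ (by linarith)]
    linarith
  linarith

lemma ContDiffAt.gapStep {E : Type*} [NormedAddCommGroup E] [NormedSpace ℝ E] {f g : E → ℝ}
    {x : E} (hf : ContDiffAt ℝ (⊤ : ℕ∞) f x) (hg : ContDiffAt ℝ (⊤ : ℕ∞) g x)
    (h : f x + g x ≠ 0) : ContDiffAt ℝ (⊤ : ℕ∞) (fun y => gapStep (f y) (g y)) x :=
  Real.smoothTransition.contDiff.contDiffAt.comp x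
    ((contDiffAt_const.mul (hf.div (hf.add hg) h)).sub contDiffAt_const)

section Weights

variable {ι : Type*} [Fintype ι] [DecidableEq ι]

/-- Detects that `x r` is much smaller than every other coordinate. -/
def facetWeight (x : ι → ℝ) (r : ι) : ℝ :=
  ∏ q ∈ Finset.univ.erase r, gapStep (x q) (x r)

/-- Detects that, for some `p`, the sum `x r + x p` is much smaller than every other
coordinate. -/
def ridgeWeight (x : ι → ℝ) (r : ι) : ℝ :=
  ∑ p ∈ Finset.univ.erase r, ∏ q ∈ (Finset.univ.erase r).erase p, gapStep (x q) (x r + x p)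

lemma facetWeight_nonneg (x : ι → ℝ) (r : ι) : 0 ≤ facetWeight x r :=
  Finset.prod_nonneg fun _ _ => gapStep_nonneg _ _

lemma facetWeight_le_one (x : ι → ℝ) (r : ι) : facetWeight x r ≤ 1 :=
  Finset.prod_le_one (fun _ _ => gapStep_nonneg _ _) fun _ _ => gapStep_le_one _ _

lemma facetWeight_eq_zero {x : ι → ℝ} (hx : ∀ i, 0 ≤ x i) {r q : ι} (hqr : q ≠ r)
    (h : x q ≤ x r) : facetWeight x r = 0 :=
  Finset.prod_eq_zero (i := q) (by simpa using hqr) (gapStep_eq_zero (hx q) h)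

lemma facetWeight_contDiffAt {x : ι → ℝ} {r : ι} (h : ∀ q, q ≠ r → 0 < x q + x r) :
    ContDiffAt ℝ (⊤ : ℕ∞) (fun y => facetWeight y r) x := by
  refine contDiffAt_prod fun q hq => ?_
  exact ContDiffAt.gapStep (contDiff_apply ℝ ℝ q).contDiffAt (contDiff_apply ℝ ℝ r).contDiffAt
    (h q (Finset.ne_of_mem_erase hq)).ne'

lemma ridgeWeight_nonneg (x : ι → ℝ) (r : ι) : 0 ≤ ridgeWeight x r :=
  Finset.sum_nonneg fun _ _ => Finset.prod_nonneg fun _ _ => gapStep_nonneg _ _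

lemma ridgeWeight_term_eq_zero {x : ι → ℝ} (hx : ∀ i, 0 ≤ x i) {r p q : ι} (hqr : q ≠ r)
    (hqp : q ≠ p) (h : x q ≤ x r + x p) :
    ∏ s ∈ (Finset.univ.erase r).erase p, gapStep (x s) (x r + x p) = 0 :=
  Finset.prod_eq_zero (i := q) (by simp [hqr, hqp]) (gapStep_eq_zero (hx q) h)

/-- At most one summand of `ridgeWeight` is nonzero. -/
lemma ridgeWeight_eq_term {x : ι → ℝ} (hx : ∀ i, 0 ≤ x i) {r p : ι} (hpr : p ≠ r)
    (h : ∀ q, q ≠ r → q ≠ p → x p ≤ x r + x q) :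
    ridgeWeight x r = ∏ q ∈ (Finset.univ.erase r).erase p, gapStep (x q) (x r + x p) := by
  refine Finset.sum_eq_single_of_mem p (by simpa using hpr) fun q hq hqp => ?_
  exact ridgeWeight_term_eq_zero hx hpr hqp.symm (h q (Finset.ne_of_mem_erase hq) hqp)

lemma ridgeWeight_le_one {x : ι → ℝ} (hx : ∀ i, 0 ≤ x i) (r : ι) : ridgeWeight x r ≤ 1 := by
  by_cases h : ∃ p, p ≠ r ∧ ∀ q, q ≠ r → q ≠ p → x p ≤ x r + x q
  · obtain ⟨p, hpr, hp⟩ := h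
    rw [ridgeWeight_eq_term hx hpr hp]
    exact Finset.prod_le_one (fun _ _ => gapStep_nonneg _ _) fun _ _ => gapStep_le_one _ _
  · have hempty : (Finset.univ.erase r : Finset ι) = ∅ := by
      by_contra hne
      obtain ⟨p, hp, hmin⟩ :=
        Finset.exists_min_image _ x (Finset.nonempty_iff_ne_empty.2 hne)
      refine h ⟨p, Finset.ne_of_mem_erase hp, fun q hqr _ => ?_⟩
      linarith [hmin q (by simpa using hqr), hx r]
    simp [ridgeWeight, hempty]

lemma ridgeWeight_contDiffAt {x : ι → ℝ} (hx : ∀ i, 0 ≤ x i) {r : ι}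
    (h : ∀ q, q ≠ r → 0 < x q + x r) :
    ContDiffAt ℝ (⊤ : ℕ∞) (fun y => ridgeWeight y r) x := by
  refine ContDiffAt.sum fun p _ => contDiffAt_prod fun q hq => ?_
  refine ContDiffAt.gapStep (contDiff_apply ℝ ℝ q).contDiffAt
    ((contDiff_apply ℝ ℝ r).contDiffAt.add (contDiff_apply ℝ ℝ p).contDiffAt) ?_
  have := h q (Finset.ne_of_mem_erase (Finset.mem_of_mem_erase hq))
  linarith [hx p]

end Weights

lemma facetWeight_permAct {n : ℕ} (σ : Equiv.Perm (Fin n)) (x : Fin n → ℝ) (r : Fin n) :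
    facetWeight (permAct σ x) r = facetWeight x (σ⁻¹ r) :=
  Finset.prod_equiv σ⁻¹ (fun q => by simp [-Equiv.Perm.coe_inv, (σ⁻¹).injective.eq_iff])
    fun _ _ => rfl

lemma ridgeWeight_permAct {n : ℕ} (σ : Equiv.Perm (Fin n)) (x : Fin n → ℝ) (r : Fin n) :
    ridgeWeight (permAct σ x) r = ridgeWeight x (σ⁻¹ r) :=
  Finset.sum_equiv σ⁻¹ (fun p => by simp [-Equiv.Perm.coe_inv, (σ⁻¹).injective.eq_iff]) fun p _ =>
    Finset.prod_equiv σ⁻¹ (fun q => by simp [-Equiv.Perm.coe_inv, (σ⁻¹).injective.eq_iff])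
      fun _ _ => rfl

lemma insertZero_self {k : ℕ} (p : Fin (k+2)) (y : Fin (k+1) → ℝ) : insertZero p y p = 0 := by
  simp [insertZero, Fin.succAbove_ne]

lemma insertZero_succAbove {k : ℕ} (p : Fin (k+2)) (y : Fin (k+1) → ℝ) (i : Fin (k+1)) :
    insertZero p y (p.succAbove i) = y i := by
  simp [insertZero]

lemma insertZero_nonneg {k : ℕ} (p : Fin (k+2)) {y : Fin (k+1) → ℝ} (hy : ∀ i, 0 ≤ y i)
    (j : Fin (k+2)) : 0 ≤ insertZero p y j := by
  refine Finset.sum_nonneg fun i _ => ?_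
  split_ifs
  exacts [hy i, le_rfl]

lemma ridgeWeight_insertZero {k : ℕ} (p : Fin (k+2)) {y : Fin (k+1) → ℝ} (hy : ∀ i, 0 ≤ y i)
    (i : Fin (k+1)) : ridgeWeight (insertZero p y) (p.succAbove i) = facetWeight y i := by
  have hx := insertZero_nonneg p hy
  rw [ridgeWeight_eq_term hx (Fin.succAbove_ne p i).symm fun q _ _ => by
    rw [insertZero_self]
    exact add_nonneg (hx _) (hx _)]
  have hset : (Finset.univ.erase (p.succAbove i)).erase p =
      (Finset.univ.erase i).map p.succAboveEmb := by
    ext q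
    rcases Fin.eq_self_or_eq_succAbove p q with rfl | ⟨j, rfl⟩ <;>
      simp [Fin.succAbove_ne]
  rw [hset, Finset.prod_map]
  simp [facetWeight, insertZero_self, insertZero_succAbove]

lemma dampedNormalize_insertZero {k : ℕ} (p : Fin (k+2)) {y : Fin (k+1) → ℝ}
    (hy : ∀ i, 0 ≤ y i) :
    dampedNormalize ridgeWeight (insertZero p y) =
      insertZero p (dampedNormalize facetWeight y) := by
  funext j
  rcases Fin.eq_self_or_eq_succAbove p j with rfl | ⟨i, rfl⟩
  · simp [dampedNormalize, insertZero_self]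
  · rw [insertZero_succAbove, dampedNormalize, dampedNormalize, Fin.sum_univ_succAbove _ p]
    simp only [insertZero_self, insertZero_succAbove, ridgeWeight_insertZero p hy, zero_mul,
      zero_add]

lemma sum_smul_vtx_apply {n : ℕ} (s : Finset (Fin n)) (t : Fin n → ℝ) (r : Fin n) :
    (∑ q ∈ s, t q • vtx q) r = if r ∈ s then t r else 0 := by
  simp [vtx]

/-- `U^k_p` consists of points whose `p`-th coordinate is small relative to all others. -/
lemma Uface_coords {k : ℕ} {p : Fin (k+1)} {x : Fin (k+1) → ℝ} (hx : x ∈ Uface k p) :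
    0 ≤ x p ∧ (∀ q, q ≠ p → 0 < x q ∧ (k + 2) * x p < x q) ∧ ∑ q, x q = 1 := by
  obtain ⟨t, htp, htq, hsum, rfl⟩ := hx
  obtain ⟨c, hc⟩ : ∃ c : ℝ, c = 1 / ((k : ℝ) + 1) := ⟨_, rfl⟩
  have hc0 : 0 < c := by rw [hc]; positivity
  have hck : c * (k + 1) = 1 := by rw [hc]; field_simp
  have hcoord : ∀ r, (t p • bprime k p + ∑ q ∈ Finset.univ.filter (fun q => q ≠ p),
      t q • vtx q) r =
        t p * (c * (c + 1)) + t r - if r = p then t p * c + t p else 0 := by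
    intro r
    rw [Pi.add_apply, sum_smul_vtx_apply]
    by_cases h : r = p
    · simp [bprime, ← hc, h]
      ring
    · simp [bprime, ← hc, h]
  simp only [hcoord, if_true]
  refine ⟨by nlinarith [mul_nonneg htp (mul_pos hc0 hc0).le], fun q hq => ?_, ?_⟩
  · have h1 := htq q hq
    rw [if_neg hq]
    refine ⟨by simp only [sub_zero]; positivity, ?_⟩
    linear_combination h1 + t p * c * hck
  · rw [Finset.sum_sub_distrib, Finset.sum_add_distrib, hsum, Finset.sum_ite_eq']
    simp only [Finset.sum_const, Finset.card_univ, Fintype.card_fin, nsmul_eq_mul,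
      Finset.mem_univ, if_true]
    push_cast
    linear_combination t p * (c + 1) * hck

/-- `U^{k+1}_{p,q}` consists of points whose `p`-th and `q`-th coordinates are small relative
to all others. -/
lemma Upair_coords {k : ℕ} {p q : Fin (k+2)} (hpq : p ≠ q) {x : Fin (k+2) → ℝ}
    (hx : x ∈ Upair k p q) :
    0 ≤ x p ∧ 0 ≤ x q ∧ (∀ r, r ≠ p → r ≠ q → 0 < x r ∧ (k + 2) * (x p + x q) < x r) ∧
      ∑ r, x r = 1 := by
  obtain ⟨t, htp, htq, htr, hsum, rfl⟩ := hx
  obtain ⟨c, hc⟩ : ∃ c : ℝ, c = 1 / ((k : ℝ) + 1) := ⟨_, rfl⟩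
  have hc0 : 0 < c := by rw [hc]; positivity
  have hck : c * (k + 1) = 1 := by rw [hc]; field_simp
  have hcoord : ∀ r, (t p • cprime k p q + t q • cprime k q p +
      ∑ r ∈ Finset.univ.filter (fun r => r ≠ p ∧ r ≠ q), t r • vtx r) r =
        (t p + t q) * (c * (c + 1)) + t r
          - (if r = p then (t p + t q) * (c * (c + 1)) + t p - t q * (c * c) else 0)
          - (if r = q then (t p + t q) * (c * (c + 1)) + t q - t p * (c * c) else 0) := by
    intro r
    rw [Pi.add_apply, sum_smul_vtx_apply]
    by_cases h : r = p
    · simp [cprime, ← hc, h, hpq]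
    · by_cases h' : r = q
      · simp [cprime, ← hc, h', hpq.symm]
      · simp [cprime, ← hc, h, h']
        ring
  simp only [hcoord, if_true, if_neg hpq, if_neg hpq.symm]
  refine ⟨by nlinarith [mul_nonneg htq (mul_pos hc0 hc0).le],
    by nlinarith [mul_nonneg htp (mul_pos hc0 hc0).le], fun r hrp hrq => ?_, ?_⟩
  · have h1 := htr r hrp hrq
    rw [if_neg hrp, if_neg hrq]
    refine ⟨by simp only [sub_zero]; positivity, ?_⟩
    linear_combination h1 + (t p + t q) * c * hck
  · rw [Finset.sum_sub_distrib, Finset.sum_sub_distrib, Finset.sum_add_distrib, hsum,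
      Finset.sum_ite_eq', Finset.sum_ite_eq']
    simp only [Finset.sum_const, Finset.card_univ, Fintype.card_fin, nsmul_eq_mul,
      Finset.mem_univ, if_true]
    push_cast
    linear_combination (t p + t q) * (c + 1) * hck

lemma eqOn_Uface {k : ℕ} (hk : 1 ≤ k) (p : Fin (k+1)) :
    Set.EqOn (dampedNormalize facetWeight) (radialProj k p) (Uface k p) := by
  intro x hx
  obtain ⟨hp, hq, hsum⟩ := Uface_coords hx
  have hk' : (1 : ℝ) ≤ k := by exact_mod_cast hk
  have hnn : ∀ i, 0 ≤ x i := fun i => by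
    by_cases h : i = p
    · exact h ▸ hp
    · exact (hq i h).1.le
  funext r
  rw [dampedNormalize_of_indicator hsum {p}]
  · simp [radialProj]
  · intro r hr
    rw [Finset.mem_singleton.1 hr]
    refine Finset.prod_eq_one fun q hqp => ?_
    obtain ⟨h0, h1⟩ := hq q (Finset.ne_of_mem_erase hqp)
    exact gapStep_eq_one hp h0 (by nlinarith)
  · intro r hr
    rw [Finset.mem_singleton] at hr
    exact facetWeight_eq_zero hnn (Ne.symm hr) (by nlinarith [hq r hr])

lemma eqOn_Upair {k : ℕ} (hk : 1 ≤ k) {p q : Fin (k+2)} (hpq : p ≠ q) :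
    Set.EqOn (dampedNormalize ridgeWeight) (pairProj k p q) (Upair k p q) := by
  intro x hx
  obtain ⟨hp, hq, hr, hsum⟩ := Upair_coords hpq hx
  have hk' : (1 : ℝ) ≤ k := by exact_mod_cast hk
  have hnn : ∀ i, 0 ≤ x i := fun i => by
    by_cases h : i = p
    · exact h ▸ hp
    by_cases h' : i = q
    · exact h' ▸ hq
    exact (hr i h h').1.le
  have hle : ∀ r, r ≠ p → r ≠ q → 3 * (x p + x q) ≤ x r := fun r hrp hrq => by
    nlinarith [hr r hrp hrq]
  have hone : ∀ a b, a ≠ b → (∀ r, r ≠ a → r ≠ b → 0 < x r ∧ 3 * (x a + x b) ≤ x r) →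
      ridgeWeight x a = 1 := by
    intro a b hab h
    rw [ridgeWeight_eq_term hnn hab.symm fun s hsa hsb => by
      linarith [h s hsa hsb, hnn a, hnn b]]
    refine Finset.prod_eq_one fun s hs => ?_
    simp only [Finset.mem_erase, Finset.mem_univ, and_true] at hs
    obtain ⟨h0, h1⟩ := h s hs.2 hs.1
    exact gapStep_eq_one (add_nonneg (hnn a) (hnn b)) h0 h1
  funext r
  rw [dampedNormalize_of_indicator hsum {p, q}]
  · simp [pairProj, Finset.sum_pair hpq, sub_sub]
  · intro r hrS
    rcases Finset.mem_insert.1 hrS with rfl | hrS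
    · exact hone r q hpq fun s h h' => ⟨(hr s h h').1, hle s h h'⟩
    · rw [Finset.mem_singleton.1 hrS]
      exact hone q p hpq.symm fun s h h' => ⟨(hr s h' h).1, by linarith [hle s h' h]⟩
  · intro r hrS
    simp only [Finset.mem_insert, Finset.mem_singleton, not_or] at hrS
    have h3 := hle r hrS.1 hrS.2
    refine Finset.sum_eq_zero fun s _ => ?_
    by_cases hsp : s = p
    · exact ridgeWeight_term_eq_zero hnn (q := q) (Ne.symm hrS.2) (hsp ▸ hpq.symm)
        (by linarith [hnn s])
    · exact ridgeWeight_term_eq_zero hnn (q := p) (Ne.symm hrS.1) (Ne.symm hsp)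
        (by linarith [hnn s])

lemma add_pos_of_notMem_skel2 {n : ℕ} {x : Fin n → ℝ} (hx : ∀ i, 0 ≤ x i) (hs : x ∉ skel2)
    {q r : Fin n} (hqr : q ≠ r) : 0 < x q + x r := by
  refine (add_nonneg (hx q) (hx r)).lt_of_ne' fun h => hs ⟨q, r, hqr, ?_, ?_⟩ <;>
    linarith [hx q, hx r]

/-- For `k ≥ 1` there exist continuous maps `φ_k : Δ^k → Δ^k` and
`φ̃_{k+1} : Δ^{k+1} → Δ^{k+1}` such that: (i) `φ_k` is smooth outside the
`(k−2)`-skeleton and `φ̃_{k+1}` outside the `(k−1)`-skeleton; (ii) `φ_k` agrees with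
the radial projection `π̃^k_p` on `U^k_p` and commutes with all vertex permutations;
(iii) `φ̃_{k+1}` agrees with the projection `π̃^{k+1}_{p,q}` on `U^{k+1}_{p,q}`,
commutes with all vertex permutations, and satisfies
`φ̃_{k+1} ∘ ι_{k+1,p} = ι_{k+1,p} ∘ φ_k` for every face inclusion. -/
theorem exists_boundary_pushing_maps (k : ℕ) (hk : 1 ≤ k) :
    ∃ (φ : (Fin (k+1) → ℝ) → (Fin (k+1) → ℝ))
      (φt : (Fin (k+2) → ℝ) → (Fin (k+2) → ℝ)),
      Set.MapsTo φ (simplexSet k) (simplexSet k) ∧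
      ContinuousOn φ (simplexSet k) ∧
      ContDiffOn ℝ (⊤ : ℕ∞) φ (simplexSet k \ skel2) ∧
      (∀ p : Fin (k+1), Set.EqOn φ (radialProj k p) (Uface k p)) ∧
      (∀ σ : Equiv.Perm (Fin (k+1)), ∀ x ∈ simplexSet k,
        φ (permAct σ x) = permAct σ (φ x)) ∧
      Set.MapsTo φt (simplexSet (k+1)) (simplexSet (k+1)) ∧
      ContinuousOn φt (simplexSet (k+1)) ∧
      ContDiffOn ℝ (⊤ : ℕ∞) φt (simplexSet (k+1) \ skel2) ∧
      (∀ p q : Fin (k+2), p ≠ q → Set.EqOn φt (pairProj k p q) (Upair k p q)) ∧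
      (∀ σ : Equiv.Perm (Fin (k+2)), ∀ x ∈ simplexSet (k+1),
        φt (permAct σ x) = permAct σ (φt x)) ∧
      (∀ p : Fin (k+2), ∀ y ∈ simplexSet k,
        φt (insertZero p y) = insertZero p (φ y)) := by
  have hf_max : ∀ x ∈ stdSimplex ℝ (Fin (k+1)), ∀ r, (∀ q, x q ≤ x r) →
      facetWeight x r = 0 := by
    intro x hx r hr
    have : Nontrivial (Fin (k+1)) := Fin.nontrivial_iff_two_le.2 (by lia)
    obtain ⟨q, hq⟩ := exists_ne r
    exact facetWeight_eq_zero hx.1 hq (hr q)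
  have hr_max : ∀ x ∈ stdSimplex ℝ (Fin (k+2)), ∀ r, (∀ q, x q ≤ x r) →
      ridgeWeight x r = 0 := by
    intro x hx r hr
    refine Finset.sum_eq_zero fun p _ => ?_
    obtain ⟨q, hqr, hqp⟩ := Fin.exists_ne_and_ne_of_two_lt r p (by lia)
    exact ridgeWeight_term_eq_zero hx.1 hqr hqp (by linarith [hr q, hx.1 p])
  have hf_le : ∀ x ∈ stdSimplex ℝ (Fin (k+1)), ∀ r, facetWeight x r ≤ 1 :=
    fun x _ => facetWeight_le_one x
  have hr_le : ∀ x ∈ stdSimplex ℝ (Fin (k+2)), ∀ r, ridgeWeight x r ≤ 1 :=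
    fun x hx => ridgeWeight_le_one hx.1
  refine ⟨dampedNormalize facetWeight, dampedNormalize ridgeWeight,
    mapsTo_dampedNormalize hf_le hf_max,
    continuousOn_dampedNormalize (fun x _ => facetWeight_nonneg x) hf_le hf_max
      fun x hx r hpos => (facetWeight_contDiffAt fun q _ =>
        add_pos_of_nonneg_of_pos (hx.1 q) hpos).continuousAt,
    contDiffOn_dampedNormalize Set.sdiff_subset hf_le hf_max fun r x hx =>
      (facetWeight_contDiffAt fun q hq =>
        add_pos_of_notMem_skel2 hx.1.1 hx.2 hq).contDiffWithinAt,
    eqOn_Uface hk,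
    fun σ x _ => dampedNormalize_permAct facetWeight_permAct σ x,
    mapsTo_dampedNormalize hr_le hr_max,
    continuousOn_dampedNormalize (fun x _ => ridgeWeight_nonneg x) hr_le hr_max
      fun x hx r hpos => (ridgeWeight_contDiffAt hx.1 fun q _ =>
        add_pos_of_nonneg_of_pos (hx.1 q) hpos).continuousAt,
    contDiffOn_dampedNormalize Set.sdiff_subset hr_le hr_max fun r x hx =>
      (ridgeWeight_contDiffAt hx.1.1 fun q hq =>
        add_pos_of_notMem_skel2 hx.1.1 hx.2 hq).contDiffWithinAt,
    fun p q => eqOn_Upair hk,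
    fun σ x _ => dampedNormalize_permAct ridgeWeight_permAct σ x,
    fun p y hy => dampedNormalize_insertZero p hy.1⟩

end
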